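/- arXiv:2405.17528 — 12 statements merged into one kernel-verified Lean document; each statement's English description precedes it below -/
import Mathlib

section
/- For every initial value q0 ∈ ℝ there exists a function q : [t0, ∞) → ℝ that is differentiable on [t0, ∞), satisfies q(t0) = q0, and satisfies q'(t) = X(t) - (μ + exp(-α·q(t))·(min(μ, X(t)) - μ)) for all t ≥ t0; that is, the logistic queue model has a global-in-time solution. -/
/-- Global-in-time existence for the logistic queue model:
for every initial value `q0 ∈ ℝ` there exists a function `q`, differentiable on `[t0, ∞)`,
with `q t0 = q0` and `q' t = X t - (μ + exp (-α * q t) * (min μ (X t) - μ))` for all `t ≥ t0`. -/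
theorem logistic_queue_existence
    (t0 μ α : ℝ) (hμ : 0 < μ) (hα : 0 < α)
    (X : ℝ → ℝ) (hXcont : ContinuousOn X (Set.Ici t0))
    (hXpos : ∀ t ∈ Set.Ici t0, 0 ≤ X t)
    (q0 : ℝ) :
    ∃ q : ℝ → ℝ, q t0 = q0 ∧
      ∀ t ∈ Set.Ici t0,
        HasDerivWithinAt q
          (X t - (μ + Real.exp (-α * q t) * (min μ (X t) - μ)))
          (Set.Ici t0) t := by
  obtain ⟨Y, hY, hYX⟩ : ∃ Y : ℝ → ℝ, Continuous Y ∧ ∀ t ∈ Set.Ici t0, Y t = X t :=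
    ⟨fun t => X (max t0 t),
      hXcont.comp_continuous (by fun_prop) fun t => le_max_left t0 t,
      fun t ht => by simp only [max_eq_right (Set.mem_Ici.1 ht)]⟩
  -- In the variable `exp (α * q)` the equation is linear; solve it by variation of constants.
  have ha : Continuous fun t => α * (Y t - μ) := by fun_prop
  let A : ℝ → ℝ := fun t => ∫ s in t0..t, α * (Y s - μ)
  have hA (t : ℝ) : HasDerivAt A (α * (Y t - μ)) t :=
    intervalIntegral.integral_hasDerivAt_right (ha.intervalIntegrable _ _)
      (ha.stronglyMeasurableAtFilter _ _) ha.continuousAt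
  have hAcont : Continuous A := continuous_iff_continuousAt.2 fun t => (hA t).continuousAt
  have hb : Continuous fun t => Real.exp (-A t) * (α * (μ - min μ (Y t))) := by fun_prop
  let W : ℝ → ℝ := fun t =>
    Real.exp (α * q0) + ∫ s in t0..t, Real.exp (-A s) * (α * (μ - min μ (Y s)))
  have hW (t : ℝ) : HasDerivAt W (Real.exp (-A t) * (α * (μ - min μ (Y t)))) t :=
    (intervalIntegral.integral_hasDerivAt_right (hb.intervalIntegrable _ _)
      (hb.stronglyMeasurableAtFilter _ _) hb.continuousAt).const_add _
  have hWpos (t : ℝ) (ht : t0 ≤ t) : 0 < W t :=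
    add_pos_of_pos_of_nonneg (Real.exp_pos _) <|
      intervalIntegral.integral_nonneg ht fun s _ =>
        mul_nonneg (Real.exp_pos _).le
          (mul_nonneg hα.le (sub_nonneg.2 (min_le_left _ _)))
  refine ⟨fun t => (A t + Real.log (W t)) / α, ?_, fun t ht => ?_⟩
  · simp [A, W, hα.ne']
  · have hpos := hWpos t ht
    have hexp : Real.exp (-α * ((A t + Real.log (W t)) / α)) = Real.exp (-A t) / W t := by
      have h : -α * ((A t + Real.log (W t)) / α) = -A t - Real.log (W t) := by
        field_simp
        ring
      rw [h, Real.exp_sub, Real.exp_log hpos]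
    have hq := (((hA t).add ((hW t).log hpos.ne')).div_const α).hasDerivWithinAt (s := Set.Ici t0)
    refine hq.congr_deriv ?_
    rw [hexp, ← hYX t ht]
    field_simp
    ring
end

section
/- Positivity of the queue: if q is a solution of the logistic queue model on [t0, T] with q(t0) = q0 ≥ 0, then q(t) ≥ 0 for all t ∈ [t0, T]. -/
/-- Positivity of the queue: a solution of the logistic queue model on `[t0, T]`
with nonnegative initial value stays nonnegative. -/
theorem logistic_queue_positivity
    (t0 T μ α : ℝ) (hμ : 0 < μ) (hα : 0 < α) (hT : t0 ≤ T)
    (X : ℝ → ℝ) (hXcont : ContinuousOn X (Set.Ici t0))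
    (hXpos : ∀ t ∈ Set.Ici t0, 0 ≤ X t)
    (q : ℝ → ℝ)
    (hq : ∀ t ∈ Set.Icc t0 T,
      HasDerivWithinAt q
        (X t - (μ + Real.exp (-α * q t) * (min μ (X t) - μ)))
        (Set.Icc t0 T) t)
    (hq0 : 0 ≤ q t0) :
    ∀ t ∈ Set.Icc t0 T, 0 ≤ q t := by
  have drift_nonneg : ∀ t ∈ Set.Icc t0 T, q t < 0 →
      0 ≤ X t - (μ + Real.exp (-α * q t) * (min μ (X t) - μ)) := by
    intro t _ hneg
    have he : 1 ≤ Real.exp (-α * q t) := Real.one_le_exp (by nlinarith)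
    rcases le_total μ (X t) with h | h
    · rw [min_eq_left h]
      linarith
    · rw [min_eq_right h]
      nlinarith
  have lower_bound : ∀ ε > 0, ∀ t ∈ Set.Icc t0 T, -q t ≤ ε * (1 + (t - t0)) := by
    intro ε hε
    refine image_le_of_deriv_right_lt_deriv_boundary (f := fun t => -q t)
      (f' := fun t => -(X t - (μ + Real.exp (-α * q t) * (min μ (X t) - μ))))
      (B := fun t => ε * (1 + (t - t0))) (B' := fun _ => ε) ?_ ?_ ?_ ?_ ?_
    · exact fun t ht => (hq t ht).continuousWithinAt.neg
    · intro t ht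
      exact ((hq t (Set.Ico_subset_Icc_self ht)).mono_of_mem_nhdsWithin
        (Icc_mem_nhdsGE_of_mem ht)).neg
    · simp only [sub_self]
      linarith
    · intro t
      simpa using (((hasDerivAt_id t).sub_const t0).const_add 1).const_mul ε
    · intro t ht h
      have hpos : 0 < ε * (1 + (t - t0)) := mul_pos hε (by linarith [ht.1])
      have h_drift := drift_nonneg t (Set.Ico_subset_Icc_self ht) (by linarith)
      linarith
  intro t ht
  by_contra! hneg
  have hlen : 0 < 1 + (t - t0) := by linarith [ht.1]
  have h := lower_bound (-q t / (2 * (1 + (t - t0)))) (by apply div_pos <;> linarith) t ht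
  have heq : -q t / (2 * (1 + (t - t0))) * (1 + (t - t0)) = -q t / 2 := by
    field_simp
  linarith
end

section
/- If the queue starts empty and the inflow never reaches the server rate, the queue remains empty: if q is a solution of the logistic queue model on [t0, T] with q(t0) = 0 and X(t) < μ for all t ∈ [t0, T], then q(t) = 0 for all t ∈ [t0, T], and consequently the outflow Y(t) = μ + exp(-α·q(t))·(min(μ, X(t)) - μ) equals X(t) for all t ∈ [t0, T]. -/
/-- If the queue starts empty and the inflow never reaches the server rate,
the queue remains empty and the outflow equals the inflow. -/
theorem logistic_queue_stays_empty
    (t0 T μ α : ℝ) (hμ : 0 < μ) (hα : 0 < α) (hT : t0 ≤ T)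
    (X : ℝ → ℝ) (hXcont : ContinuousOn X (Set.Ici t0))
    (hXpos : ∀ t ∈ Set.Ici t0, 0 ≤ X t)
    (q : ℝ → ℝ)
    (hq : ∀ t ∈ Set.Icc t0 T,
      HasDerivWithinAt q
        (X t - (μ + Real.exp (-α * q t) * (min μ (X t) - μ)))
        (Set.Icc t0 T) t)
    (hq0 : q t0 = 0)
    (hXlt : ∀ t ∈ Set.Icc t0 T, X t < μ) :
    ∀ t ∈ Set.Icc t0 T,
      q t = 0 ∧ μ + Real.exp (-α * q t) * (min μ (X t) - μ) = X t := by
  have hr : ∀ t ∈ Set.Icc t0 T,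
      HasDerivWithinAt (fun s => Real.exp (α * q s) - 1)
        (-α * (μ - X t) * (Real.exp (α * q t) - 1)) (Set.Icc t0 T) t := by
    intro t ht
    refine (((hq t ht).const_mul α).exp.sub_const 1).congr_deriv ?_
    have he : Real.exp (α * q t) * Real.exp (-α * q t) = 1 := by
      rw [← Real.exp_add]
      simp
    rw [min_eq_right (hXlt t ht).le]
    linear_combination (α * (μ - X t)) * he
  have hzero := eq_zero_of_abs_deriv_le_mul_abs_self_of_eq_zero_right (K := α * μ)
    (fun t ht => (hr t ht).continuousWithinAt)
    (fun t ht => (hr t (Set.Ico_subset_Icc_self ht)).mono_of_mem_nhdsWithin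
      (Icc_mem_nhdsGE_of_mem ht))
    (by simp [hq0])
    (fun t ht => by
      have hX := hXlt t (Set.Ico_subset_Icc_self ht)
      have hX0 := hXpos t ht.1
      rw [norm_mul, norm_mul, norm_neg, Real.norm_of_nonneg hα.le,
        Real.norm_of_nonneg (sub_nonneg.2 hX.le)]
      gcongr
      linarith)
  intro t ht
  have hqt : q t = 0 := by
    have h := (Real.exp_eq_one_iff _).1 (sub_eq_zero.1 (hzero t ht))
    exact (mul_eq_zero.1 h).resolve_left hα.ne'
  refine ⟨hqt, ?_⟩
  rw [hqt, min_eq_right (hXlt t ht).le]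
  simp
end

section
/- A priori bound on the queue size: if q is a solution of the logistic queue model on [t0, T] with q(t0) = q0 ≥ 0, then for every t ∈ [t0, T] one has q(t) ≤ q0 + ∫_{t0}^{t} X(s) ds. -/
/-- The logistic outflow rate is nonnegative as long as the queue and the inflow are. -/
theorem logistic_outflow_nonneg {μ α x y : ℝ} (hμ : 0 < μ) (hα : 0 < α) (hx : 0 ≤ x)
    (hy : 0 ≤ y) : 0 ≤ μ + Real.exp (-α * y) * (min μ x - μ) := by
  have he : Real.exp (-α * y) ≤ 1 := Real.exp_le_one_iff.2 (by nlinarith)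
  have hm : 0 ≤ min μ x := le_min hμ.le hx
  nlinarith [Real.exp_pos (-α * y), mul_nonneg (Real.exp_pos (-α * y)).le hm]

/-- A priori bound on the queue size:
`q t ≤ q0 + ∫ s in t0..t, X s` for every `t ∈ [t0, T]`. -/
theorem logistic_queue_apriori_bound
    (t0 T μ α : ℝ) (hμ : 0 < μ) (hα : 0 < α) (hT : t0 ≤ T)
    (X : ℝ → ℝ) (hXcont : ContinuousOn X (Set.Ici t0))
    (hXpos : ∀ t ∈ Set.Ici t0, 0 ≤ X t)
    (q : ℝ → ℝ) (q0 : ℝ)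
    (hq : ∀ t ∈ Set.Icc t0 T,
      HasDerivWithinAt q
        (X t - (μ + Real.exp (-α * q t) * (min μ (X t) - μ)))
        (Set.Icc t0 T) t)
    (hq0 : q t0 = q0) (hq0pos : 0 ≤ q0) :
    ∀ t ∈ Set.Icc t0 T, q t ≤ q0 + ∫ s in t0..t, X s := by
  intro t ht
  set Y : ℝ → ℝ := fun s ↦ X (max t0 s) with hY
  have hYcont : Continuous Y :=
    hXcont.comp_continuous (continuous_const.max continuous_id) fun s ↦ le_max_left t0 s
  have hYX : ∀ s, t0 ≤ s → Y s = X s := fun s hs ↦ by simp [hY, max_eq_right hs]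
  have hYnonneg : ∀ s, 0 ≤ Y s := fun s ↦ hXpos _ (le_max_left t0 s)
  have hint : ∫ s in t0..t, X s = ∫ s in t0..t, Y s :=
    intervalIntegral.integral_congr fun s hs ↦ by
      rw [Set.uIcc_of_le ht.1] at hs
      exact (hYX s hs.1).symm
  rw [hint]
  -- Compare `q` with the strict upper barrier `q0 + ∫ Y + ε (t - t0)`, then let `ε → 0`.
  have key : ∀ ε > 0, q t ≤ (q0 + ∫ s in t0..t, Y s) + ε * (t - t0) := by
    intro ε hε
    have hB : ∀ x, HasDerivAt (fun x ↦ (q0 + ∫ s in t0..x, Y s) + ε * (x - t0)) (Y x + ε) x := by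
      intro x
      have h1 := (hYcont.integral_hasStrictDerivAt t0 x).hasDerivAt.const_add q0
      have h2 := ((hasDerivAt_id x).sub_const t0).const_mul ε
      simpa using h1.fun_add h2
    refine image_le_of_deriv_right_lt_deriv_boundary
      (f' := fun x ↦ X x - (μ + Real.exp (-α * q x) * (min μ (X x) - μ)))
      (fun x hx ↦ (hq x hx).continuousWithinAt)
      (fun x hx ↦ (hq x ⟨hx.1, hx.2.le⟩).mono_of_mem_nhdsWithin (Icc_mem_nhdsGE_of_mem hx))
      (by simp [hq0]) hB (fun x hx hqx ↦ ?_) ht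
    have hx0 : 0 ≤ q x := by
      have h1 : 0 ≤ ∫ s in t0..x, Y s :=
        intervalIntegral.integral_nonneg hx.1 fun s _ ↦ hYnonneg s
      have h2 : 0 ≤ ε * (x - t0) := mul_nonneg hε.le (sub_nonneg.2 hx.1)
      linarith
    have hout := logistic_outflow_nonneg hμ hα (hXpos x hx.1) hx0
    rw [hYX x hx.1]
    linarith
  have hlim : Filter.Tendsto (fun ε : ℝ ↦ (q0 + ∫ s in t0..t, Y s) + ε * (t - t0))
      (nhdsWithin 0 (Set.Ioi 0)) (nhds (q0 + ∫ s in t0..t, Y s)) := by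
    refine Filter.Tendsto.mono_left ?_ nhdsWithin_le_nhds
    exact Continuous.tendsto' (by fun_prop) _ _ (by simp)
  exact ge_of_tendsto hlim (eventually_mem_nhdsWithin.mono key)
end

section
/- FIFO property of the logistic queue model: let q be a solution of the logistic queue model on [t0, ∞) with q(t0) = q0 ≥ 0, and define the exit time Λ(t) = t + q(t)/μ. Then Λ is strictly increasing: for all t, s ∈ [t0, ∞) with t < s one has Λ(t) < Λ(s). -/
/-- FIFO property of the logistic queue model: the exit time `Λ t = t + q t / μ`
is strictly increasing on `[t0, ∞)`. -/
theorem logistic_queue_fifo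
    (t0 μ α : ℝ) (hμ : 0 < μ) (hα : 0 < α)
    (X : ℝ → ℝ) (hXcont : ContinuousOn X (Set.Ici t0))
    (hXpos : ∀ t ∈ Set.Ici t0, 0 ≤ X t)
    (q : ℝ → ℝ) (q0 : ℝ)
    (hq : ∀ t ∈ Set.Ici t0,
      HasDerivWithinAt q
        (X t - (μ + Real.exp (-α * q t) * (min μ (X t) - μ)))
        (Set.Ici t0) t)
    (hq0 : q t0 = q0) (hq0pos : 0 ≤ q0) :
    ∀ t ∈ Set.Ici t0, ∀ s ∈ Set.Ici t0, t < s →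
      t + q t / μ < s + q s / μ := by
  have hΛ : ∀ t ∈ Set.Ici t0, HasDerivWithinAt (fun t => t + q t / μ)
      (1 + (X t - (μ + Real.exp (-α * q t) * (min μ (X t) - μ))) / μ) (Set.Ici t0) t :=
    fun t ht => (hasDerivWithinAt_id t _).add ((hq t ht).div_const μ)
  have hmono : StrictMonoOn (fun t => t + q t / μ) (Set.Ici t0) := by
    refine strictMonoOn_of_deriv_pos (convex_Ici t0)
      (fun t ht => (hΛ t ht).continuousWithinAt) fun t ht => ?_
    rw [interior_Ici] at ht
    have htm : t ∈ Set.Ici t0 := Set.Ioi_subset_Ici_self ht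
    rw [((hΛ t htm).hasDerivAt (Ici_mem_nhds ht)).deriv]
    have hE := Real.exp_pos (-α * q t)
    have hsum : 0 < X t + Real.exp (-α * q t) * (μ - min μ (X t)) := by
      rcases (hXpos t htm).eq_or_lt with h | h
      · rw [← h, min_eq_right hμ.le]
        simpa using mul_pos hE hμ
      · exact add_pos_of_pos_of_nonneg h
          (mul_nonneg hE.le (sub_nonneg.2 (min_le_left _ _)))
    calc 0 < (X t + Real.exp (-α * q t) * (μ - min μ (X t))) / μ := div_pos hsum hμ
      _ = _ := by
        field_simp
        ring
  exact fun t ht s hs hts => hmono ht hs hts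
end

section
/- Gronwall-type logarithmic estimate: let α > 0, β > 0, tX ∈ ℝ, and let q : [tX, T] → ℝ be differentiable with q(t) > 0 for all t ∈ [tX, T] and q'(t) ≤ -β·α·q(t)/(1 + α·q(t)) for all t ∈ [tX, T]. Then for every t ∈ [tX, T] one has q(t) + log(q(t))/α ≤ q(tX) + log(q(tX))/α - β·(t - tX). -/
/-- Gronwall-type logarithmic estimate: if `q > 0` on `[tX, T]` and
`q' t ≤ -β * α * q t / (1 + α * q t)`, then
`q t + log (q t) / α ≤ q tX + log (q tX) / α - β * (t - tX)`. -/
theorem gronwall_log_estimate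
    (α β tX T : ℝ) (hα : 0 < α) (hβ : 0 < β) (hT : tX ≤ T)
    (q q' : ℝ → ℝ)
    (hderiv : ∀ t ∈ Set.Icc tX T, HasDerivWithinAt q (q' t) (Set.Icc tX T) t)
    (hqpos : ∀ t ∈ Set.Icc tX T, 0 < q t)
    (hineq : ∀ t ∈ Set.Icc tX T, q' t ≤ -β * α * q t / (1 + α * q t)) :
    ∀ t ∈ Set.Icc tX T,
      q t + Real.log (q t) / α ≤ q tX + Real.log (q tX) / α - β * (t - tX) := by
  have hF : ∀ t ∈ Set.Icc tX T, HasDerivWithinAt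
      (fun s => q s + Real.log (q s) / α + β * s) (q' t + q' t / q t / α + β * 1)
      (Set.Icc tX T) t := fun t ht =>
    ((hderiv t ht).add (((hderiv t ht).log (hqpos t ht).ne').div_const α)).add
      ((hasDerivWithinAt_id t _).const_mul β)
  have hanti : AntitoneOn (fun s => q s + Real.log (q s) / α + β * s) (Set.Icc tX T) := by
    refine antitoneOn_of_hasDerivWithinAt_nonpos (convex_Icc tX T)
      (fun t ht => (hF t ht).continuousWithinAt)
      (fun t ht => (hF t (interior_subset ht)).mono interior_subset) fun t ht => ?_
    have hq := hqpos t (interior_subset ht)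
    have hle := hineq t (interior_subset ht)
    rw [le_div_iff₀ (by positivity)] at hle
    have heq : q' t + q' t / q t / α + β * 1 =
        (q' t * (1 + α * q t) + β * α * q t) / (α * q t) := by
      field_simp
      ring
    rw [heq]
    exact div_nonpos_of_nonpos_of_nonneg (by linarith) (by positivity)
  intro t ht
  have h := hanti (Set.left_mem_Icc.2 hT) ht ht.1
  simp only at h
  linarith
end

section
/- Exponential decay of the queue: let q be a solution of the logistic queue model on [t0, ∞) with q(t0) ≥ 0, suppose there are tX ≥ t0 and X∞ with 0 ≤ X∞ < μ such that X(t) ≤ X∞ for all t ≥ tX, and suppose q(s) > 0 for all s ∈ [tX, t] for a given t ≥ tX. Then, writing β = μ - X∞, qX = q(tX), and K = qX + log(qX)/α + β·tX, one has q(t)^{1/α}·exp(q(t)) ≤ exp(-β·t + K), and in particular q(t) ≤ exp(α·(K - β·t)). -/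
/-- The elementary inequality `u ≤ (1 - exp (-u)) * (1 + u)`. -/
theorem le_one_sub_exp_neg_mul_one_add (u : ℝ) : u ≤ (1 - Real.exp (-u)) * (1 + u) := by
  have h : Real.exp (-u) * (1 + u) ≤ Real.exp (-u) * Real.exp u :=
    mul_le_mul_of_nonneg_left (by linarith [Real.add_one_le_exp u]) (Real.exp_pos _).le
  rw [← Real.exp_add, neg_add_cancel, Real.exp_zero] at h
  linarith

/-- While the inflow `x` is at most `y < μ`, the logistic queue dynamics make
`q + log q / α + (μ - y) * t` nonincreasing. -/
theorem logistic_queue_rate_nonpos {μ α x y p : ℝ} (hα : 0 < α) (hp : 0 < p)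
    (hxy : x ≤ y) (hy : y < μ) :
    x - (μ + Real.exp (-α * p) * (min μ x - μ)) +
      (x - (μ + Real.exp (-α * p) * (min μ x - μ))) / p / α + (μ - y) ≤ 0 := by
  have hu : 0 < α * p := mul_pos hα hp
  have h := le_one_sub_exp_neg_mul_one_add (α * p)
  rw [min_eq_right (hxy.trans hy.le), neg_mul]
  set e := Real.exp (-(α * p))
  have h1 : 1 ≤ (1 - e) * (1 + α * p) / (α * p) := (one_le_div hu).2 h
  have h2 : (μ - y) * 1 ≤ (μ - x) * ((1 - e) * (1 + α * p) / (α * p)) :=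
    mul_le_mul (by linarith) h1 zero_le_one (by linarith)
  have h3 : x - (μ + e * (x - μ)) + (x - (μ + e * (x - μ))) / p / α =
      -((μ - x) * ((1 - e) * (1 + α * p) / (α * p))) := by
    field_simp
    ring
  linarith

/-- Exponential decay of the queue: under eventually subcritical inflow and while the
queue stays positive on `[tX, t]`, with `β = μ - Xinf`, `qX = q tX` and
`K = qX + log qX / α + β * tX`, one has `q t ^ (1/α) * exp (q t) ≤ exp (-β * t + K)` and
in particular `q t ≤ exp (α * (K - β * t))`. -/
theorem logistic_queue_exponential_decay
    (t0 μ α : ℝ) (hμ : 0 < μ) (hα : 0 < α)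
    (X : ℝ → ℝ) (hXcont : ContinuousOn X (Set.Ici t0))
    (hXpos : ∀ t ∈ Set.Ici t0, 0 ≤ X t)
    (q : ℝ → ℝ)
    (hq : ∀ t ∈ Set.Ici t0,
      HasDerivWithinAt q
        (X t - (μ + Real.exp (-α * q t) * (min μ (X t) - μ)))
        (Set.Ici t0) t)
    (hq0 : 0 ≤ q t0)
    (tX Xinf : ℝ) (htX : t0 ≤ tX) (hXinf0 : 0 ≤ Xinf) (hXinfμ : Xinf < μ)
    (hXbound : ∀ t, tX ≤ t → X t ≤ Xinf)
    (t : ℝ) (ht : tX ≤ t)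
    (hqpos : ∀ s ∈ Set.Icc tX t, 0 < q s) :
    q t ^ (1 / α) * Real.exp (q t) ≤
        Real.exp (-(μ - Xinf) * t + (q tX + Real.log (q tX) / α + (μ - Xinf) * tX)) ∧
      q t ≤ Real.exp (α * ((q tX + Real.log (q tX) / α + (μ - Xinf) * tX) - (μ - Xinf) * t)) := by
  set F : ℝ → ℝ := fun s => q s + Real.log (q s) / α + (μ - Xinf) * s with hF
  have hsub : Set.Icc tX t ⊆ Set.Ici t0 := fun s hs => htX.trans hs.1
  have hderiv : ∀ s ∈ Set.Icc tX t, HasDerivWithinAt F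
      (X s - (μ + Real.exp (-α * q s) * (min μ (X s) - μ)) +
        (X s - (μ + Real.exp (-α * q s) * (min μ (X s) - μ))) / q s / α + (μ - Xinf))
      (Set.Icc tX t) s := by
    intro s hs
    have h := (hq s (hsub hs)).mono hsub
    have h' := (h.add ((h.log (hqpos s hs).ne').div_const α)).add
      ((hasDerivWithinAt_id s (Set.Icc tX t)).const_mul (μ - Xinf))
    rw [mul_one] at h'
    exact h'
  have hanti : AntitoneOn F (Set.Icc tX t) :=
    antitoneOn_of_hasDerivWithinAt_nonpos (convex_Icc tX t)
      (fun s hs => (hderiv s hs).continuousWithinAt)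
      (fun s hs => (hderiv s (interior_subset hs)).mono interior_subset)
      (fun s hs => logistic_queue_rate_nonpos hα (hqpos s (interior_subset hs))
        (hXbound s (interior_subset hs).1) hXinfμ)
  have hle : F t ≤ F tX := hanti (Set.left_mem_Icc.2 ht) (Set.right_mem_Icc.2 ht) ht
  simp only [hF] at hle
  have hpos : 0 < q t := hqpos t (Set.right_mem_Icc.2 ht)
  constructor
  · rw [Real.rpow_def_of_pos hpos, ← Real.exp_add, mul_one_div]
    exact Real.exp_le_exp.2 (by linarith)
  · rw [← Real.log_le_iff_le_exp hpos, mul_comm, ← div_le_iff₀ hα]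
    linarith
end

section
/- Asymptotic emptying of the queue: let q be a solution of the logistic queue model on [t0, ∞) with q(t0) = q0 ≥ 0. If there exist tX ≥ t0 and X∞ with 0 ≤ X∞ < μ such that X(t) ≤ X∞ for all t ≥ tX, then q(t) → 0 as t → +∞. -/
/-- Asymptotic emptying of the queue: if eventually `X t ≤ Xinf < μ`, then `q t → 0`
as `t → +∞`. -/
theorem logistic_queue_tendsto_zero
    (t0 μ α : ℝ) (hμ : 0 < μ) (hα : 0 < α)
    (X : ℝ → ℝ) (hXcont : ContinuousOn X (Set.Ici t0))
    (hXpos : ∀ t ∈ Set.Ici t0, 0 ≤ X t)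
    (q : ℝ → ℝ) (q0 : ℝ)
    (hq : ∀ t ∈ Set.Ici t0,
      HasDerivWithinAt q
        (X t - (μ + Real.exp (-α * q t) * (min μ (X t) - μ)))
        (Set.Ici t0) t)
    (hq0 : q t0 = q0) (hq0pos : 0 ≤ q0)
    (tX Xinf : ℝ) (htX : t0 ≤ tX) (hXinf0 : 0 ≤ Xinf) (hXinfμ : Xinf < μ)
    (hXbound : ∀ t, tX ≤ t → X t ≤ Xinf) :
    Filter.Tendsto q Filter.atTop (nhds 0) := by
  set c := μ - Xinf with hc
  have hcpos : 0 < c := sub_pos.mpr hXinfμ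
  set u : ℝ → ℝ := fun t => Real.exp (α * q t) - 1 with hu
  have hu' : ∀ t ∈ Set.Ici tX,
      HasDerivWithinAt u (-(α * (μ - X t) * u t)) (Set.Ici tX) t := by
    intro t ht
    have hqt := (hq t (htX.trans ht)).mono (Set.Ici_subset_Ici.mpr htX)
    refine ((hqt.const_mul α).exp.sub_const 1).congr_deriv ?_
    have hmin : min μ (X t) = X t := min_eq_right ((hXbound t ht).trans hXinfμ.le)
    have hexp : Real.exp (α * q t) * Real.exp (-α * q t) = 1 := by
      rw [← Real.exp_add]; simp
    rw [hmin]
    simp only [hu]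
    linear_combination (-α * (X t - μ)) * hexp
  have hw' : ∀ t ∈ Set.Ici tX,
      HasDerivWithinAt (fun t => u t ^ 2 * Real.exp (2 * α * c * t))
        (2 * α * (c - (μ - X t)) * (u t ^ 2 * Real.exp (2 * α * c * t))) (Set.Ici tX) t := by
    intro t ht
    refine (((hu' t ht).pow 2).mul
      ((hasDerivWithinAt_id t _).const_mul (2 * α * c)).exp).congr_deriv ?_
    simp
    ring
  have hanti : AntitoneOn (fun t => u t ^ 2 * Real.exp (2 * α * c * t)) (Set.Ici tX) := by
    refine antitoneOn_of_hasDerivWithinAt_nonpos (convex_Ici tX)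
      (fun t ht => (hw' t ht).continuousWithinAt)
      (fun t ht => (hw' t (interior_subset ht)).mono interior_subset) fun t ht => ?_
    have hXt := hXbound t (interior_subset ht)
    refine mul_nonpos_of_nonpos_of_nonneg
      (mul_nonpos_of_nonneg_of_nonpos (by positivity) (by linarith)) (by positivity)
  have hdecay : Filter.Tendsto (fun t => u tX ^ 2 * Real.exp (2 * α * c * tX) *
      Real.exp (-(2 * α * c * t))) Filter.atTop (nhds 0) := by
    have hlin : Filter.Tendsto (fun t : ℝ => 2 * α * c * t) Filter.atTop Filter.atTop :=
      Filter.tendsto_id.const_mul_atTop (by positivity)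
    simpa using (Real.tendsto_exp_neg_atTop_nhds_zero.comp hlin).const_mul
      (u tX ^ 2 * Real.exp (2 * α * c * tX))
  have husq : Filter.Tendsto (fun t => u t ^ 2) Filter.atTop (nhds 0) := by
    refine squeeze_zero' (.of_forall fun t => sq_nonneg (u t)) ?_ hdecay
    filter_upwards [Filter.eventually_ge_atTop tX] with t ht
    rw [Real.exp_neg, ← div_eq_mul_inv, le_div_iff₀ (Real.exp_pos _)]
    exact hanti Set.self_mem_Ici ht ht
  have hu0 : Filter.Tendsto u Filter.atTop (nhds 0) := by
    refine (tendsto_zero_iff_abs_tendsto_zero u).mpr ?_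
    simpa [Real.sqrt_sq_eq_abs, Function.comp_def] using husq.sqrt
  have hlog : Filter.Tendsto (fun t => Real.log (u t + 1) / α) Filter.atTop (nhds 0) := by
    have h := ((hu0.add_const 1).log (by norm_num)).div_const α
    simpa using h
  refine hlog.congr fun t => ?_
  simp [hu, hα.ne']
end

section
/- Existence, uniqueness and positivity for the logistic finite-queue model: for every q0 ≥ 0 there exists a function q : [t0, ∞) → ℝ, differentiable on [t0, ∞) with q(t0) = q0, satisfying the logistic finite-queue equation q'(t) = X̂(q(t), t) - (μ + exp(-α·q(t))·(min(μ, X̂(q(t), t)) - μ)) for all t ≥ t0; any two solutions on an interval [t0, T] with the same initial value coincide; and every such solution satisfies q(t) ≥ 0 for all t ≥ t0. -/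
open Set Filter Topology

/-- Net inflow of a queue of length `q` with cutoff `h` and exogenous inflow `x`. -/
noncomputable def queueField (μ α : ℝ) (h : ℝ → ℝ) (q x : ℝ) : ℝ :=
  h q * x - (μ + Real.exp (-α * q) * (min μ (h q * x) - μ))

section QueueField

variable {μ α : ℝ} {h : ℝ → ℝ} {q x : ℝ}

lemma locallyLipschitz_queueField (hh : ContDiff ℝ 1 h) :
    LocallyLipschitz fun p : ℝ × ℝ ↦ queueField μ α h p.1 p.2 := by
  have hg : ContDiff ℝ 1 fun p : ℝ × ℝ ↦ h p.1 * p.2 :=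
    (hh.comp contDiff_fst).mul contDiff_snd
  have hm : LocallyLipschitz fun p : ℝ × ℝ ↦ min μ (h p.1 * p.2) := hg.locallyLipschitz.const_min μ
  have hΨ : ContDiff ℝ 1 fun p : (ℝ × ℝ) × ℝ ↦
      h p.1.1 * p.1.2 - (μ + Real.exp (-α * p.1.1) * (p.2 - μ)) := by
    fun_prop
  exact hΨ.locallyLipschitz.comp (LocallyLipschitz.id.prodMk hm)

lemma abs_queueField_le (hμ : 0 ≤ μ) (hα : 0 ≤ α) (hh0 : 0 ≤ h q) (hh1 : h q ≤ 1)
    (hq : 0 ≤ q) (hx : 0 ≤ x) : |queueField μ α h q x| ≤ max μ x := by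
  have hy : 0 ≤ h q * x := mul_nonneg hh0 hx
  have hyx : h q * x ≤ x := mul_le_of_le_one_left hx hh1
  have he : Real.exp (-α * q) ≤ 1 := Real.exp_le_one_iff.2 (by nlinarith)
  have he0 := Real.exp_pos (-α * q)
  have := le_max_left μ x
  have := le_max_right μ x
  unfold queueField
  rw [abs_le]
  rcases min_cases μ (h q * x) with ⟨h1, h2⟩ | ⟨h1, h2⟩ <;> rw [h1] <;> constructor <;> nlinarith

lemma queueField_nonneg_of_nonpos (hα : 0 ≤ α) (hq : q ≤ 0) : 0 ≤ queueField μ α h q x := by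
  have he : 1 ≤ Real.exp (-α * q) := Real.one_le_exp (by nlinarith)
  unfold queueField
  rcases min_cases μ (h q * x) with ⟨h1, h2⟩ | ⟨h1, h2⟩ <;> rw [h1] <;> nlinarith

end QueueField

/-- A function that starts nonnegative and is nondecreasing wherever it is negative stays
nonnegative. -/
lemma nonneg_of_hasDerivWithinAt_of_neg {a b : ℝ} {q q' : ℝ → ℝ}
    (hq : ∀ t ∈ Icc a b, HasDerivWithinAt q (q' t) (Icc a b) t)
    (hneg : ∀ t ∈ Icc a b, q t < 0 → 0 ≤ q' t) (ha : 0 ≤ q a) {t : ℝ} (ht : t ∈ Icc a b) :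
    0 ≤ q t := by
  have key (ε : ℝ) (hε : 0 < ε) : -q t ≤ ε * (1 + (t - a)) := by
    have hB (s : ℝ) : HasDerivAt (fun s ↦ ε * (1 + (s - a))) ε s := by
      simpa using (((hasDerivAt_id s).sub_const a).const_add 1).const_mul ε
    refine image_le_of_deriv_right_lt_deriv_boundary (f := fun s ↦ -q s) (f' := fun s ↦ -q' s)
      (B := fun s ↦ ε * (1 + (s - a))) (B' := fun _ ↦ ε)
      (fun s hs ↦ (hq s hs).continuousWithinAt.neg) (fun s hs ↦ ?_) ?_ hB (fun s hs hsB ↦ ?_) ht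
    · exact ((hq s (Ico_subset_Icc_self hs)).mono_of_mem_nhdsWithin
        (Icc_mem_nhdsGE_of_mem hs)).neg
    · simp only [sub_self]; linarith
    · have : 0 < ε * (1 + (s - a)) := mul_pos hε (by linarith [hs.1])
      have := hneg s (Ico_subset_Icc_self hs) (by linarith)
      linarith
  have hpos : 0 < 1 + (t - a) := by linarith [ht.1]
  refine neg_nonpos.1 (le_of_forall_pos_le_add fun ε hε ↦ ?_)
  simpa [div_mul_cancel₀ _ hpos.ne'] using key (ε / (1 + (t - a))) (div_pos hε hpos)

/-- Solutions on all compact intervals `[a, b]` glue to a solution on `[a, ∞)` when solutions are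
unique. -/
lemma exists_hasDerivWithinAt_Ici_of_forall_Icc {E : Type*} [NormedAddCommGroup E]
    [NormedSpace ℝ E] {v : ℝ → E → E} {a : ℝ} {x₀ : E}
    (hex : ∀ b, a ≤ b → ∃ f : ℝ → E, f a = x₀ ∧
      ∀ t ∈ Icc a b, HasDerivWithinAt f (v t (f t)) (Icc a b) t)
    (huniq : ∀ b, a ≤ b → ∀ f g : ℝ → E,
      (∀ t ∈ Icc a b, HasDerivWithinAt f (v t (f t)) (Icc a b) t) →
      (∀ t ∈ Icc a b, HasDerivWithinAt g (v t (g t)) (Icc a b) t) →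
      f a = g a → ∀ t ∈ Icc a b, f t = g t) :
    ∃ f : ℝ → E, f a = x₀ ∧ ∀ t ∈ Ici a, HasDerivWithinAt f (v t (f t)) (Ici a) t := by
  choose Q hQa hQ using fun n : ℕ ↦ hex (a + n) (by simp)
  have agree {m n : ℕ} (hmn : m ≤ n) : ∀ t ∈ Icc a (a + m), Q m t = Q n t := by
    have hsub : Icc a (a + m) ⊆ Icc a (a + (n : ℝ)) := Icc_subset_Icc_right (by gcongr)
    exact huniq _ (by simp) _ _ (hQ m) (fun t ht ↦ (hQ n t (hsub ht)).mono hsub)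
      ((hQa m).trans (hQa n).symm)
  have lt_floor (t : ℝ) : t < a + (⌊t - a⌋₊ + 1 : ℕ) := by
    push_cast
    linarith [Nat.lt_floor_add_one (t - a)]
  have eqQ {N : ℕ} {s : ℝ} (hs : s ∈ Ico a (a + N)) : Q (⌊s - a⌋₊ + 1) s = Q N s :=
    agree ((Nat.floor_lt (sub_nonneg.2 hs.1)).2 (by linarith [hs.2])) s ⟨hs.1, (lt_floor s).le⟩
  refine ⟨fun t ↦ Q (⌊t - a⌋₊ + 1) t, hQa _, fun t ht ↦ ?_⟩
  have htN := lt_floor t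
  have hmem : Ico a (a + (⌊t - a⌋₊ + 1 : ℕ)) ∈ 𝓝[Ici a] t := by
    rw [← Ici_inter_Iio]
    exact inter_mem self_mem_nhdsWithin (mem_nhdsWithin_of_mem_nhds (Iio_mem_nhds htN))
  refine ((hQ _ t ⟨ht, htN.le⟩).mono_of_mem_nhdsWithin
    (mem_of_superset hmem Ico_subset_Icc_self)).congr_of_eventuallyEq ?_ rfl
  filter_upwards [hmem] with s hs using eqQ hs

section Solutions

variable {μ α : ℝ} {h X : ℝ → ℝ} {a b : ℝ}

lemma exists_lipschitzOnWith_queueField (hh : ContDiff ℝ 1 h) (hX : ContinuousOn X (Icc a b))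
    {s : Set ℝ} (hs : IsCompact s) :
    ∃ K, ∀ t ∈ Icc a b, LipschitzOnWith K (fun q ↦ queueField μ α h q (X t)) s := by
  obtain ⟨K, hK⟩ := ((locallyLipschitz_queueField (μ := μ) (α := α)
    hh).locallyLipschitzOn (s := s ×ˢ (X '' Icc a b))).exists_lipschitzOnWith_of_compact
      (hs.prod (isCompact_Icc.image_of_continuousOn hX))
  refine ⟨K, fun t ht ↦ ?_⟩
  have := hK.comp (LipschitzWith.prodMk_right (X t)).lipschitzOnWith (s := s)
    fun q hq ↦ ⟨hq, mem_image_of_mem X ht⟩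
  simpa only [mul_one, Function.comp_def] using this

lemma queueField_solution_unique (hh : ContDiff ℝ 1 h) (hX : ContinuousOn X (Icc a b))
    {f g : ℝ → ℝ}
    (hf : ∀ t ∈ Icc a b, HasDerivWithinAt f (queueField μ α h (f t) (X t)) (Icc a b) t)
    (hg : ∀ t ∈ Icc a b, HasDerivWithinAt g (queueField μ α h (g t) (X t)) (Icc a b) t)
    (ha : f a = g a) : EqOn f g (Icc a b) := by
  have hfc : ContinuousOn f (Icc a b) := fun t ht ↦ (hf t ht).continuousWithinAt
  have hgc : ContinuousOn g (Icc a b) := fun t ht ↦ (hg t ht).continuousWithinAt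
  obtain ⟨K, hK⟩ := exists_lipschitzOnWith_queueField (μ := μ) (α := α) hh hX
    ((isCompact_Icc.image_of_continuousOn hfc).union (isCompact_Icc.image_of_continuousOn hgc))
  exact ODE_solution_unique_of_mem_Icc_right (v := fun t q ↦ queueField μ α h q (X t))
    (fun t ht ↦ hK t (Ico_subset_Icc_self ht)) hfc
    (fun t ht ↦ (hf t (Ico_subset_Icc_self ht)).mono_of_mem_nhdsWithin (Icc_mem_nhdsGE_of_mem ht))
    (fun t ht ↦ .inl (mem_image_of_mem f (Ico_subset_Icc_self ht))) hgc
    (fun t ht ↦ (hg t (Ico_subset_Icc_self ht)).mono_of_mem_nhdsWithin (Icc_mem_nhdsGE_of_mem ht))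
    (fun t ht ↦ .inr (mem_image_of_mem g (Ico_subset_Icc_self ht))) ha

lemma exists_queueField_solution (hμ : 0 ≤ μ) (hα : 0 ≤ α) (hh : ContDiff ℝ 1 h)
    (hh0 : ∀ q, 0 ≤ h q) (hh1 : ∀ q, h q ≤ 1) (hX : ContinuousOn X (Icc a b))
    (hX0 : ∀ t ∈ Icc a b, 0 ≤ X t) (hab : a ≤ b) {q0 : ℝ} (hq0 : 0 ≤ q0) :
    ∃ q : ℝ → ℝ, q a = q0 ∧
      ∀ t ∈ Icc a b, HasDerivWithinAt q (queueField μ α h (q t) (X t)) (Icc a b) t := by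
  obtain ⟨B, hB⟩ := isCompact_Icc.bddAbove_image hX
  have hB (t : ℝ) (ht : t ∈ Icc a b) : X t ≤ B := hB (mem_image_of_mem X ht)
  let L : NNReal := ⟨max μ B, hμ.trans (le_max_left _ _)⟩
  let r : NNReal := L * (b - a).toNNReal
  have hmax : LipschitzWith 1 fun q : ℝ ↦ max q 0 := LipschitzWith.id.max_const 0
  obtain ⟨K, hK⟩ := exists_lipschitzOnWith_queueField (μ := μ) (α := α) hh hX
    ((isCompact_closedBall q0 r).image hmax.continuous)
  have hPL : IsPicardLindelof (fun t q ↦ queueField μ α h (max q 0) (X t))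
      (⟨a, left_mem_Icc.2 hab⟩ : Icc a b) q0 r 0 L (K * 1) := by
    refine ⟨fun t ht ↦ (hK t ht).comp hmax.lipschitzOnWith (mapsTo_image _ _),
      fun q _ ↦ ?_, fun t ht q _ ↦ ?_, ?_⟩
    · exact (locallyLipschitz_queueField hh).continuous.comp_continuousOn
        (continuousOn_const.prodMk hX)
    · exact (abs_queueField_le hμ hα (hh0 _) (hh1 _) (le_max_right _ _) (hX0 t ht)).trans
        (max_le_max_left μ (hB t ht))
    · simp [r, hab]
  obtain ⟨q, hqa, hq⟩ := hPL.exists_eq_forall_mem_Icc_hasDerivWithinAt₀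
  refine ⟨q, hqa, fun t ht ↦ ?_⟩
  have hq_nonneg : 0 ≤ q t := nonneg_of_hasDerivWithinAt_of_neg hq
    (fun s _ hs ↦ queueField_nonneg_of_nonpos hα (max_eq_right hs.le).le) (hqa ▸ hq0) ht
  simpa [max_eq_left hq_nonneg] using hq t ht

end Solutions

/-- Existence, uniqueness and positivity for the logistic finite-queue model, where
`Hn q = 1/(1 + (1/H0 - 1) * exp (n * (q - k)))`, the effective inflow is
`Xhat q t = Hn q * X t`, and the right-hand side of the ODE is
`F qv t = Xhat qv t - (μ + exp (-α * qv) * (min μ (Xhat qv t) - μ))`. -/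
theorem logistic_finite_queue_existence_uniqueness_positivity
    (t0 μ α k n H0 : ℝ) (hμ : 0 < μ) (hα : 0 < α) (hk : 0 < k) (hn : 0 < n)
    (hH0 : 0 < H0) (hH0' : H0 ≤ 1)
    (X : ℝ → ℝ) (hXcont : ContinuousOn X (Set.Ici t0))
    (hXpos : ∀ t ∈ Set.Ici t0, 0 ≤ X t)
    (Xhat : ℝ → ℝ → ℝ)
    (hXhat : ∀ qv t, Xhat qv t =
      (1 / (1 + (1 / H0 - 1) * Real.exp (n * (qv - k)))) * X t)
    (F : ℝ → ℝ → ℝ)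
    (hF : ∀ qv t, F qv t =
      Xhat qv t - (μ + Real.exp (-α * qv) * (min μ (Xhat qv t) - μ)))
    (q0 : ℝ) (hq0 : 0 ≤ q0) :
    (∃ q : ℝ → ℝ, q t0 = q0 ∧
        ∀ t ∈ Set.Ici t0, HasDerivWithinAt q (F (q t) t) (Set.Ici t0) t) ∧
    (∀ T : ℝ, t0 ≤ T → ∀ q1 q2 : ℝ → ℝ,
        (∀ t ∈ Set.Icc t0 T, HasDerivWithinAt q1 (F (q1 t) t) (Set.Icc t0 T) t) →
        (∀ t ∈ Set.Icc t0 T, HasDerivWithinAt q2 (F (q2 t) t) (Set.Icc t0 T) t) →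
        q1 t0 = q2 t0 → ∀ t ∈ Set.Icc t0 T, q1 t = q2 t) ∧
    (∀ q : ℝ → ℝ,
        (∀ t ∈ Set.Ici t0, HasDerivWithinAt q (F (q t) t) (Set.Ici t0) t) →
        q t0 = q0 → ∀ t ∈ Set.Ici t0, 0 ≤ q t) := by
  let h : ℝ → ℝ := fun q ↦ 1 / (1 + (1 / H0 - 1) * Real.exp (n * (q - k)))
  have hc : 0 ≤ 1 / H0 - 1 := sub_nonneg.2 (one_le_one_div hH0 hH0')
  have hden (q : ℝ) : 1 ≤ 1 + (1 / H0 - 1) * Real.exp (n * (q - k)) :=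
    le_add_of_nonneg_right (mul_nonneg hc (Real.exp_pos _).le)
  have hh : ContDiff ℝ 1 h :=
    contDiff_const.div (by fun_prop) fun q ↦ (zero_lt_one.trans_le (hden q)).ne'
  have hh0 (q : ℝ) : 0 ≤ h q := one_div_nonneg.2 (zero_le_one.trans (hden q))
  have hh1 (q : ℝ) : h q ≤ 1 := (div_le_one (zero_lt_one.trans_le (hden q))).2 (hden q)
  have hFh (q t : ℝ) : F q t = queueField μ α h q (X t) := by
    simp only [hF, hXhat, queueField, h]
  have hXIcc (T : ℝ) : ContinuousOn X (Icc t0 T) := hXcont.mono Icc_subset_Ici_self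
  simp only [hFh]
  have huniq (T : ℝ) (_ : t0 ≤ T) (f g : ℝ → ℝ)
      (hf : ∀ t ∈ Icc t0 T, HasDerivWithinAt f (queueField μ α h (f t) (X t)) (Icc t0 T) t)
      (hg : ∀ t ∈ Icc t0 T, HasDerivWithinAt g (queueField μ α h (g t) (X t)) (Icc t0 T) t)
      (hfg : f t0 = g t0) : ∀ t ∈ Icc t0 T, f t = g t :=
    queueField_solution_unique hh (hXIcc T) hf hg hfg
  refine ⟨exists_hasDerivWithinAt_Ici_of_forall_Icc
    (v := fun t q ↦ queueField μ α h q (X t)) (fun T hT ↦ ?_) huniq, huniq,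
    fun q hq hq_init t ht ↦ ?_⟩
  · exact exists_queueField_solution hμ.le hα.le hh hh0 hh1 (hXIcc T)
      (fun t ht ↦ hXpos t ht.1) hT hq0
  · exact nonneg_of_hasDerivWithinAt_of_neg (b := t)
      (fun s hs ↦ (hq s hs.1).mono Icc_subset_Ici_self)
      (fun s _ hs ↦ queueField_nonneg_of_nonpos hα.le hs.le) (hq_init ▸ hq0) ⟨ht, le_rfl⟩
end

section
/- Asymptotic emptying for the logistic finite-queue model: let q be a solution of the logistic finite-queue model on [t0, ∞) with q(t0) ≥ 0. If there exist tX ≥ t0 and X∞ with 0 ≤ X∞ < μ such that X(t) ≤ X∞ for all t ≥ tX, then q(t) → 0 as t → +∞. -/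
/-- A function that starts nonnegative and is nondecreasing wherever it is negative stays
nonnegative. -/
theorem nonneg_of_deriv_nonneg_of_neg {f f' : ℝ → ℝ} {a : ℝ}
    (hf : ∀ t ∈ Set.Ici a, HasDerivWithinAt f (f' t) (Set.Ici a) t) (ha : 0 ≤ f a)
    (hf' : ∀ t ∈ Set.Ici a, f t < 0 → 0 ≤ f' t) {t : ℝ} (ht : a ≤ t) : 0 ≤ f t := by
  have key : ∀ ε > 0, -f t ≤ ε + ε * (t - a) := by
    intro ε hε
    refine image_le_of_deriv_right_lt_deriv_boundary (f := fun s => -f s) (f' := fun s => -f' s)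
      (B := fun s => ε + ε * (s - a)) (B' := fun _ => ε) (a := a) (b := t)
      (fun s hs => ((hf s hs.1).continuousWithinAt.mono Set.Icc_subset_Ici_self).neg)
      (fun s hs => ((hf s hs.1).mono (Set.Ici_subset_Ici.2 hs.1)).neg)
      (by simp; linarith) (fun s => ?_) (fun s hs h => ?_) (Set.right_mem_Icc.2 ht)
    · simpa using (((hasDerivAt_id s).sub_const a).const_mul ε).const_add ε
    · have : 0 ≤ ε * (s - a) := mul_nonneg hε.le (sub_nonneg.2 hs.1)
      have := hf' s hs.1 (by linarith)
      linarith
  by_contra! h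
  have hpos : 0 < 1 + (t - a) := by linarith
  have h2 := key (-f t / 2 / (1 + (t - a))) (by apply div_pos <;> linarith)
  have h3 : -f t / 2 / (1 + (t - a)) + -f t / 2 / (1 + (t - a)) * (t - a) = -f t / 2 := by
    field_simp
    ring
  linarith

/-- A nonnegative function with `f' ≤ -φ (f)` for a monotone `φ` that vanishes at `0` and is
positive on positive numbers tends to zero. -/
theorem tendsto_zero_of_deriv_le_neg_comp {f f' φ : ℝ → ℝ} {a : ℝ}
    (hcont : ContinuousOn f (Set.Ici a)) (hf : ∀ t, a < t → HasDerivAt f (f' t) t)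
    (hnonneg : ∀ t, a ≤ t → 0 ≤ f t) (hf' : ∀ t, a < t → f' t ≤ -φ (f t))
    (hφ : Monotone φ) (hφ0 : φ 0 = 0) (hφpos : ∀ x, 0 < x → 0 < φ x) :
    Filter.Tendsto f Filter.atTop (nhds 0) := by
  have hdiff : DifferentiableOn ℝ f (interior (Set.Ici a)) := by
    rw [interior_Ici]
    exact fun t ht => (hf t ht).differentiableAt.differentiableWithinAt
  have hanti : AntitoneOn f (Set.Ici a) := by
    refine antitoneOn_of_deriv_nonpos (convex_Ici a) hcont hdiff fun t ht => ?_
    rw [interior_Ici] at ht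
    rw [(hf t ht).deriv]
    have := hφ (hnonneg t (le_of_lt ht))
    linarith [hf' t ht]
  rw [Metric.tendsto_atTop]
  intro ε hε
  obtain ⟨T, hT, hTε⟩ : ∃ T, a ≤ T ∧ f T < ε := by
    by_contra! h
    have hd := hφpos ε hε
    have hT : a ≤ a + (f a + 1) / φ ε := by
      have := hnonneg a le_rfl
      have : 0 ≤ (f a + 1) / φ ε := by positivity
      linarith
    have hle := (convex_Ici a).image_sub_le_mul_sub_of_deriv_le hcont hdiff (C := -φ ε)
      (fun t ht => by
        rw [interior_Ici] at ht
        rw [(hf t ht).deriv]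
        linarith [hf' t ht, hφ (h t (le_of_lt ht))])
      a Set.self_mem_Ici _ hT hT
    have heq : -φ ε * (a + (f a + 1) / φ ε - a) = -(f a + 1) := by
      field_simp
      ring
    linarith [hnonneg _ hT]
  refine ⟨T, fun t ht => ?_⟩
  rw [Real.dist_eq, sub_zero, abs_of_nonneg (hnonneg t (hT.trans ht))]
  exact (hanti hT (hT.trans ht) ht).trans_lt hTε


/-- Asymptotic emptying for the logistic finite-queue model: if eventually
`X t ≤ Xinf < μ`, then `q t → 0` as `t → +∞`. -/
theorem logistic_finite_queue_tendsto_zero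
    (t0 μ α k n H0 : ℝ) (hμ : 0 < μ) (hα : 0 < α) (hk : 0 < k) (hn : 0 < n)
    (hH0 : 0 < H0) (hH0' : H0 ≤ 1)
    (X : ℝ → ℝ) (hXcont : ContinuousOn X (Set.Ici t0))
    (hXpos : ∀ t ∈ Set.Ici t0, 0 ≤ X t)
    (Xhat : ℝ → ℝ → ℝ)
    (hXhat : ∀ qv t, Xhat qv t =
      (1 / (1 + (1 / H0 - 1) * Real.exp (n * (qv - k)))) * X t)
    (F : ℝ → ℝ → ℝ)
    (hF : ∀ qv t, F qv t =
      Xhat qv t - (μ + Real.exp (-α * qv) * (min μ (Xhat qv t) - μ)))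
    (q : ℝ → ℝ)
    (hq : ∀ t ∈ Set.Ici t0, HasDerivWithinAt q (F (q t) t) (Set.Ici t0) t)
    (hq0 : 0 ≤ q t0)
    (tX Xinf : ℝ) (htX : t0 ≤ tX) (hXinf0 : 0 ≤ Xinf) (hXinfμ : Xinf < μ)
    (hXbound : ∀ t, tX ≤ t → X t ≤ Xinf) :
    Filter.Tendsto q Filter.atTop (nhds 0) := by
  have hnonneg : ∀ t, t0 ≤ t → 0 ≤ q t := by
    intro t ht
    refine nonneg_of_deriv_nonneg_of_neg hq hq0 (fun s _ hs => ?_) ht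
    have he : 1 ≤ Real.exp (-α * q s) := Real.one_le_exp (by nlinarith)
    rw [hF]
    rcases le_total μ (Xhat (q s) s) with h | h
    · rw [min_eq_left h]
      linarith
    · rw [min_eq_right h]
      nlinarith
  refine tendsto_zero_of_deriv_le_neg_comp (a := tX) (f' := fun t => F (q t) t)
    (φ := fun x => (μ - Xinf) * (1 - Real.exp (-α * x)))
    (fun t ht => (hq t (htX.trans ht)).continuousWithinAt.mono (Set.Ici_subset_Ici.2 htX))
    (fun t ht => (hq t (htX.trans ht.le)).hasDerivAt (Ici_mem_nhds (htX.trans_lt ht)))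
    (fun t ht => hnonneg t (htX.trans ht)) (fun t ht => ?_) (fun x y hxy => ?_) (by simp)
    (fun x hx => ?_)
  · have hq_nonneg := hnonneg t (htX.trans ht.le)
    have he : Real.exp (-α * q t) ≤ 1 := Real.exp_le_one_iff.2 (by nlinarith)
    have hX : Xhat (q t) t ≤ Xinf := by
      have hH : 0 ≤ (1 / H0 - 1) * Real.exp (n * (q t - k)) :=
        mul_nonneg (sub_nonneg.2 (one_le_one_div hH0 hH0')) (Real.exp_pos _).le
      rw [hXhat]
      refine (mul_le_of_le_one_left (hXpos t (htX.trans ht.le)) ?_).trans (hXbound t ht.le)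
      rw [div_le_one (by linarith)]
      linarith
    simp only [hF]
    rw [min_eq_right (hX.trans hXinfμ.le)]
    nlinarith
  · have : Real.exp (-α * y) ≤ Real.exp (-α * x) := Real.exp_le_exp.2 (by nlinarith)
    exact mul_le_mul_of_nonneg_left (by linarith) (by linarith)
  · have : Real.exp (-α * x) < 1 := Real.exp_lt_one_iff.2 (by nlinarith)
    exact mul_pos (by linarith) (by linarith)
end

section
/- FIFO property for the logistic finite-queue model: let q be a solution of the logistic finite-queue model on [t0, ∞) with q(t0) = q0 ≥ 0, and define the exit time Λ(t) = t + q(t)/μ. Then for all t, s ∈ [t0, ∞) with t < s one has Λ(t) < Λ(s). -/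
/-- FIFO property for the logistic finite-queue model: the exit time
`Λ t = t + q t / μ` is strictly increasing on `[t0, ∞)`. -/
theorem logistic_finite_queue_fifo
    (t0 μ α k n H0 : ℝ) (hμ : 0 < μ) (hα : 0 < α) (hk : 0 < k) (hn : 0 < n)
    (hH0 : 0 < H0) (hH0' : H0 ≤ 1)
    (X : ℝ → ℝ) (hXcont : ContinuousOn X (Set.Ici t0))
    (hXpos : ∀ t ∈ Set.Ici t0, 0 ≤ X t)
    (Xhat : ℝ → ℝ → ℝ)
    (hXhat : ∀ qv t, Xhat qv t =
      (1 / (1 + (1 / H0 - 1) * Real.exp (n * (qv - k)))) * X t)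
    (F : ℝ → ℝ → ℝ)
    (hF : ∀ qv t, F qv t =
      Xhat qv t - (μ + Real.exp (-α * qv) * (min μ (Xhat qv t) - μ)))
    (q : ℝ → ℝ) (q0 : ℝ)
    (hq : ∀ t ∈ Set.Ici t0, HasDerivWithinAt q (F (q t) t) (Set.Ici t0) t)
    (hq0 : q t0 = q0) (hq0pos : 0 ≤ q0) :
    ∀ t ∈ Set.Ici t0, ∀ s ∈ Set.Ici t0, t < s →
      t + q t / μ < s + q s / μ := by
  have hXhat_nonneg : ∀ t ∈ Set.Ici t0, 0 ≤ Xhat (q t) t := by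
    intro t ht
    rw [hXhat]
    have hH : 0 ≤ 1 / H0 - 1 := sub_nonneg.mpr ((one_le_div hH0).mpr hH0')
    exact mul_nonneg (by positivity) (hXpos t ht)
  have hF_gt : ∀ t ∈ Set.Ici t0, -μ < F (q t) t := by
    intro t ht
    have hx := hXhat_nonneg t ht
    have he := Real.exp_pos (-α * q t)
    rw [hF]
    rcases le_or_gt μ (Xhat (q t) t) with h | h
    · rw [min_eq_left h]
      linarith
    · rw [min_eq_right h.le]
      nlinarith [mul_pos he (sub_pos.mpr h)]
  have hmono : StrictMonoOn (fun t => t + q t / μ) (Set.Ici t0) := by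
    refine strictMonoOn_of_deriv_pos (convex_Ici t0) ?_ ?_
    · exact continuousOn_id.add
        (ContinuousOn.div_const (fun t ht => (hq t ht).continuousWithinAt) μ)
    · intro t ht
      rw [interior_Ici] at ht
      have ht' : t ∈ Set.Ici t0 := Set.Ioi_subset_Ici_self ht
      have hd := (hasDerivAt_id' t).add
        (((hq t ht').hasDerivAt (Ici_mem_nhds ht)).div_const μ)
      have hpos : 0 < 1 + F (q t) t / μ := by
        have h := (lt_div_iff₀ hμ).mpr (by linarith [hF_gt t ht'] : -1 * μ < F (q t) t)
        linarith
      exact hd.deriv.symm ▸ hpos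
  exact fun t ht s hs hts => hmono ht hs hts
end

section
/- Boundedness of the finite queue by its capacity: let MX ≥ μ be a constant with X(t) ≤ MX for all t ≥ t0, and set H0 = μ/MX in the logistic cutoff. If q is a solution of the logistic finite-queue model on [t0, ∞) with 0 ≤ q(t0) < k, then q(t) ≤ k for all t ≥ t0 (and this holds for every n > 0). -/
/-- The logistic cutoff with level `μ / M` brings an inflow bounded by `M` down to at most `μ`
as soon as the queue reaches its capacity. -/
theorem logistic_cutoff_mul_le {μ M k n x y : ℝ} (hμ : 0 < μ) (hM : μ ≤ M) (hn : 0 ≤ n)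
    (hk : k ≤ y) (hx : x ≤ M) :
    1 / (1 + (1 / (μ / M) - 1) * Real.exp (n * (y - k))) * x ≤ μ := by
  have hc : 0 ≤ M / μ - 1 := sub_nonneg.2 ((one_le_div hμ).2 hM)
  have he : 1 ≤ Real.exp (n * (y - k)) :=
    Real.one_le_exp (mul_nonneg hn (sub_nonneg.2 hk))
  have hD : M / μ ≤ 1 + (M / μ - 1) * Real.exp (n * (y - k)) := by
    nlinarith [mul_nonneg hc (sub_nonneg.2 he)]
  rw [one_div_div, one_div_mul_eq_div, div_le_iff₀ (by positivity)]
  calc x ≤ μ * (M / μ) := by rwa [mul_div_cancel₀ _ hμ.ne']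
    _ ≤ _ := by gcongr

/-- A function with nonpositive right derivative wherever it is at least `k` cannot exceed `k`
when it starts at or below `k`. -/
theorem le_of_hasDerivWithinAt_Ici_nonpos {f f' : ℝ → ℝ} {a k : ℝ}
    (hf : ∀ t ∈ Set.Ici a, HasDerivWithinAt f (f' t) (Set.Ici a) t) (ha : f a ≤ k)
    (hf' : ∀ t ∈ Set.Ici a, k ≤ f t → f' t ≤ 0) {t : ℝ} (ht : t ∈ Set.Ici a) : f t ≤ k := by
  have barrier : ∀ ε > 0, f t ≤ k + ε * (t - a) := fun ε hε =>
    image_le_of_deriv_right_lt_deriv_boundary (a := a) (b := t) (f' := f')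
      (B := fun x => k + ε * (x - a)) (B' := fun _ => ε)
      (fun x hx => (hf x hx.1).continuousWithinAt.mono Set.Icc_subset_Ici_self)
      (fun x hx => (hf x hx.1).mono (Set.Ici_subset_Ici.2 hx.1))
      (by simpa using ha)
      (fun x => by simpa using (((hasDerivAt_id x).sub_const a).const_mul ε).const_add k)
      (fun x hx hxB => (hf' x hx.1 (hxB ▸ le_add_of_nonneg_right
        (mul_nonneg hε.le (sub_nonneg.2 hx.1)))).trans_lt hε)
      (Set.right_mem_Icc.2 ht)
  have hlim : Filter.Tendsto (fun ε : ℝ => k + ε * (t - a)) (nhdsWithin 0 (Set.Ioi 0))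
      (nhds k) := by
    have : Continuous fun ε : ℝ => k + ε * (t - a) := by fun_prop
    simpa using (this.tendsto 0).mono_left nhdsWithin_le_nhds
  exact ge_of_tendsto hlim (Filter.eventually_of_mem self_mem_nhdsWithin barrier)

/-- Boundedness of the finite queue by its capacity: if `X t ≤ MX` for all `t ≥ t0`,
with `MX ≥ μ` and the cutoff level chosen as `H0 = μ / MX`, then any solution of the
logistic finite-queue model starting with `0 ≤ q t0 < k` satisfies `q t ≤ k` for all
`t ≥ t0` (for every `n > 0`). -/
theorem logistic_finite_queue_bounded_by_capacity
    (t0 μ α k n H0 : ℝ) (hμ : 0 < μ) (hα : 0 < α) (hk : 0 < k) (hn : 0 < n)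
    (MX : ℝ) (hMX : μ ≤ MX)
    (hH0 : H0 = μ / MX)
    (X : ℝ → ℝ) (hXcont : ContinuousOn X (Set.Ici t0))
    (hXpos : ∀ t ∈ Set.Ici t0, 0 ≤ X t)
    (hXle : ∀ t, t0 ≤ t → X t ≤ MX)
    (Xhat : ℝ → ℝ → ℝ)
    (hXhat : ∀ qv t, Xhat qv t =
      (1 / (1 + (1 / H0 - 1) * Real.exp (n * (qv - k)))) * X t)
    (F : ℝ → ℝ → ℝ)
    (hF : ∀ qv t, F qv t =
      Xhat qv t - (μ + Real.exp (-α * qv) * (min μ (Xhat qv t) - μ)))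
    (q : ℝ → ℝ)
    (hq : ∀ t ∈ Set.Ici t0, HasDerivWithinAt q (F (q t) t) (Set.Ici t0) t)
    (hq0nonneg : 0 ≤ q t0) (hq0lt : q t0 < k) :
    ∀ t ∈ Set.Ici t0, q t ≤ k := by
  intro t ht
  refine le_of_hasDerivWithinAt_Ici_nonpos hq hq0lt.le (fun s hs hks => ?_) ht
  have hle : Xhat (q s) s ≤ μ := by
    rw [hXhat, hH0]
    exact logistic_cutoff_mul_le hμ hMX hn.le hks (hXle s hs)
  have he : Real.exp (-α * q s) ≤ 1 :=
    Real.exp_le_one_iff.2 (by nlinarith [mul_nonneg hα.le (hk.le.trans hks)])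
  rw [hF, min_eq_right hle]
  nlinarith [mul_nonneg (sub_nonneg.2 hle) (sub_nonneg.2 he)]
end
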